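/- arXiv:2210.14726 — 2 statements merged into one kernel-verified Lean document; each statement's English description precedes it below -/
import Mathlib

section
/- Let G be a group equipped with a bi-invariant metric d. Suppose μ₁, μ₂ : G → ℝ are homogeneous quasimorphisms, each of which is Lipschitz with respect to d (there is K > 0 with |μ_i(g) − μ_i(h)| ≤ K·d(g,h) for all g, h and i = 1, 2), and suppose there exist g₁, g₂ ∈ G with μ₁(g₁)·μ₂(g₂) − μ₁(g₂)·μ₂(g₁) ≠ 0. Then there is no quasi-isometry from (G, d) to ℝ with its standard metric. (This is the group-theoretic mechanism behind Theorem D: since Ham(𝔻_k) for k = 3, 4 carries two linearly independent Hofer-Lipschitz homogeneous quasimorphisms, it is not quasi-isometric to the real line with respect to the Hofer metric, answering the Kapovich–Polterovich question in the negative.) -/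
/-- The mechanism behind Theorem D (Kapovich–Polterovich question): if a group `G` with a
bi-invariant metric `d` carries two homogeneous quasimorphisms `μ₁, μ₂` that are Lipschitz
with respect to `d` and linearly independent (witnessed by `μ₁(g₁)μ₂(g₂) − μ₁(g₂)μ₂(g₁) ≠ 0`),
then there is no quasi-isometry from `(G, d)` to `ℝ` with its standard metric. -/
theorem no_quasi_isometry_to_real_line {G : Type*} [Group G] (d : G → G → ℝ)
    (hd_symm : ∀ g h : G, d g h = d h g)
    (hd_eq : ∀ g h : G, d g h = 0 ↔ g = h)
    (hd_tri : ∀ g h k : G, d g k ≤ d g h + d h k)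
    (hd_left : ∀ g h k : G, d (k * g) (k * h) = d g h)
    (hd_right : ∀ g h k : G, d (g * k) (h * k) = d g h)
    (μ₁ μ₂ : G → ℝ)
    (hq₁ : ∃ C : ℝ, ∀ g h : G, |μ₁ (g * h) - μ₁ g - μ₁ h| ≤ C)
    (hq₂ : ∃ C : ℝ, ∀ g h : G, |μ₂ (g * h) - μ₂ g - μ₂ h| ≤ C)
    (hhom₁ : ∀ (g : G) (k : ℕ), μ₁ (g ^ k) = (k : ℝ) * μ₁ g)
    (hhom₂ : ∀ (g : G) (k : ℕ), μ₂ (g ^ k) = (k : ℝ) * μ₂ g)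
    (K : ℝ) (hK : 0 < K)
    (hLip₁ : ∀ g h : G, |μ₁ g - μ₁ h| ≤ K * d g h)
    (hLip₂ : ∀ g h : G, |μ₂ g - μ₂ h| ≤ K * d g h)
    (g₁ g₂ : G)
    (hindep : μ₁ g₁ * μ₂ g₂ - μ₁ g₂ * μ₂ g₁ ≠ 0) :
    ¬ ∃ (f : G → ℝ) (A B : ℝ), 1 ≤ A ∧ 0 ≤ B ∧
        (∀ g h : G, A⁻¹ * d g h - B ≤ |f g - f h| ∧ |f g - f h| ≤ A * d g h + B) ∧
        (∀ y : ℝ, ∃ g : G, |y - f g| ≤ B) := by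
  rintro ⟨f, A, B, hA, hB, hf, -⟩
  obtain ⟨C₁, hC₁⟩ := hq₁
  obtain ⟨C₂, hC₂⟩ := hq₂
  have hA0 : 0 < A := by linarith
  have hdself : ∀ g, d g g = 0 := fun g => (hd_eq g g).2 rfl
  have hdnn : ∀ g h, 0 ≤ d g h := by
    intro g h
    have h1 := hd_tri g h g
    rw [hdself, hd_symm h g] at h1
    linarith
  have hmul : ∀ g h, d (g * h) 1 ≤ d g 1 + d h 1 := by
    intro g h
    have h1 := hd_tri (g * h) h 1
    have h2 := hd_right g 1 h
    rw [one_mul] at h2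
    linarith
  have hpow : ∀ (g : G) (k : ℕ), d (g ^ k) 1 ≤ k * d g 1 := by
    intro g k
    induction k with
    | zero => simp [hdself]
    | succ k ih =>
      have h1 := hmul (g ^ k) g
      rw [pow_succ]
      push_cast
      linarith
  set R : ℝ := A * (1 + B) with hR
  set S : ℝ := K * R + 2 * C₁ + 2 * C₂ with hS
  have hC₁0 : 0 ≤ C₁ := (abs_nonneg _).trans (hC₁ 1 1)
  have hC₂0 : 0 ≤ C₂ := (abs_nonneg _).trans (hC₂ 1 1)
  set Δ : ℝ := μ₁ g₁ * μ₂ g₂ - μ₁ g₂ * μ₂ g₁ with hΔ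
  have hΔ0 : 0 < |Δ| := abs_pos.2 hindep
  set T : ℝ := S * |μ₁ g₁| + S * |μ₂ g₁| + S * |μ₁ g₂| + S * |μ₂ g₂| with hT
  have hR0 : 0 ≤ R := by positivity
  have hS0 : 0 ≤ S := by positivity
  obtain ⟨L, hL⟩ := exists_nat_gt (T / |Δ|)
  rw [div_lt_iff₀ hΔ0] at hL
  let P : ℕ → ℕ → G := fun m n => g₁ ^ (L * m) * g₂ ^ (L * n)
  have hsep : ∀ m n m' n' : ℕ, |f (P m n) - f (P m' n')| < 1 → m = m' ∧ n = n' := by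
    intro m n m' n' h
    have hd : d (P m n) (P m' n') ≤ R := by
      have h1 := (hf (P m n) (P m' n')).1
      have h2 : A⁻¹ * d (P m n) (P m' n') ≤ 1 + B := by linarith
      rwa [inv_mul_le_iff₀ hA0] at h2
    have hKd : K * d (P m n) (P m' n') ≤ K * R := mul_le_mul_of_nonneg_left hd hK.le
    have key : ∀ (μ : G → ℝ) (C : ℝ), (∀ g h : G, |μ (g * h) - μ g - μ h| ≤ C) →
        (∀ (g : G) (k : ℕ), μ (g ^ k) = (k : ℝ) * μ g) →
        (∀ g h : G, |μ g - μ h| ≤ K * d g h) → 2 * C ≤ 2 * C₁ + 2 * C₂ →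
        |(L : ℝ) * (((m : ℝ) - m') * μ g₁ + ((n : ℝ) - n') * μ g₂)| ≤ S := by
      intro μ C h1 h2 h3 h4
      have e1 := h1 (g₁ ^ (L * m)) (g₂ ^ (L * n))
      have e2 := h1 (g₁ ^ (L * m')) (g₂ ^ (L * n'))
      have e3 := h3 (P m n) (P m' n')
      simp only [h2] at e1 e2
      push_cast at e1 e2
      change |μ (P m n) - _ - _| ≤ _ at e1
      change |μ (P m' n') - _ - _| ≤ _ at e2
      rw [abs_le] at e1 e2 e3 ⊢
      constructor <;> nlinarith
    have k1 := key μ₁ C₁ hC₁ hhom₁ hLip₁ (by linarith)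
    have k2 := key μ₂ C₂ hC₂ hhom₂ hLip₂ (by linarith)
    set X := (L : ℝ) * (((m : ℝ) - m') * μ₁ g₁ + ((n : ℝ) - n') * μ₁ g₂) with hX
    set Y := (L : ℝ) * (((m : ℝ) - m') * μ₂ g₁ + ((n : ℝ) - n') * μ₂ g₂) with hY
    have bd : ∀ p q : ℝ, |X * p - Y * q| ≤ S * |p| + S * |q| := by
      intro p q
      refine (abs_sub _ _).trans ?_
      rw [abs_mul X p, abs_mul Y q]
      gcongr
    have fin : ∀ a b : ℕ, |(L : ℝ) * ((a : ℝ) - b) * Δ| ≤ T → a = b := by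
      intro a b hab
      by_contra hne
      have h1 : (1 : ℝ) ≤ |(a : ℝ) - b| := by
        have : (1 : ℤ) ≤ |(a : ℤ) - b| := Int.one_le_abs (by omega)
        exact_mod_cast this
      rw [abs_mul, abs_mul, Nat.abs_cast] at hab
      have : (L : ℝ) * |Δ| ≤ L * |(a : ℝ) - b| * |Δ| := by
        have : (L : ℝ) * 1 ≤ L * |(a : ℝ) - b| := by gcongr
        nlinarith
      linarith
    have z1 : 0 ≤ S * |μ₁ g₁| := by positivity
    have z2 : 0 ≤ S * |μ₂ g₁| := by positivity
    have z3 : 0 ≤ S * |μ₁ g₂| := by positivity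
    have z4 : 0 ≤ S * |μ₂ g₂| := by positivity
    constructor
    · apply fin
      have := bd (μ₂ g₂) (μ₁ g₂)
      have e : (L : ℝ) * ((m : ℝ) - m') * Δ = X * μ₂ g₂ - Y * μ₁ g₂ := by
        rw [hX, hY, hΔ]; ring
      rw [e]; linarith
    · apply fin
      have := bd (μ₂ g₁) (μ₁ g₁)
      have e : (L : ℝ) * ((n : ℝ) - n') * Δ = -(X * μ₂ g₁ - Y * μ₁ g₁) := by
        rw [hX, hY, hΔ]; ring
      rw [e, abs_neg]; linarith
  obtain ⟨M, hM⟩ := exists_nat_gt (A * (L * (d g₁ 1 + d g₂ 1)) + B)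
  have hx1 := hdnn g₁ 1
  have hx2 := hdnn g₂ 1
  have hM1 : 1 ≤ M := by
    have : (0 : ℝ) < M := lt_of_le_of_lt (by positivity) hM
    exact_mod_cast this
  set N : ℕ := 2 * M + 1 with hN
  have hbound : ∀ m n : ℕ, m < N → n < N → |f (P m n) - f 1| ≤ (M * N : ℕ) := by
    intro m n hm hn
    have h1 := (hf (P m n) 1).2
    have h2 : d (P m n) 1 ≤ N * (L * (d g₁ 1 + d g₂ 1)) := by
      have a1 := hmul (g₁ ^ (L * m)) (g₂ ^ (L * n))
      have a2 := hpow g₁ (L * m)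
      have a3 := hpow g₂ (L * n)
      have a4 : ((L * m : ℕ) : ℝ) * d g₁ 1 ≤ ((L * N : ℕ) : ℝ) * d g₁ 1 := by gcongr
      have a5 : ((L * n : ℕ) : ℝ) * d g₂ 1 ≤ ((L * N : ℕ) : ℝ) * d g₂ 1 := by gcongr
      push_cast at a4 a5 a2 a3
      change d (P m n) 1 ≤ _ at a1
      linarith
    have h3 : A * d (P m n) 1 ≤ A * (N * (L * (d g₁ 1 + d g₂ 1))) := by gcongr
    have hN1 : (1 : ℝ) ≤ N := by exact_mod_cast (by omega : 1 ≤ N)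
    have h4 : B * 1 ≤ B * N := by gcongr
    have h5 : (A * (L * (d g₁ 1 + d g₂ 1)) + B) * N ≤ M * N := by gcongr
    push_cast
    linarith
  let s : Finset (ℕ × ℕ) := Finset.range N ×ˢ Finset.range N
  let t : Finset ℤ := Finset.Icc (-((M * N : ℕ) : ℤ)) ((M * N : ℕ) : ℤ)
  have hcard : s.card ≤ t.card := by
    apply Finset.card_le_card_of_injOn (fun p => ⌊f (P p.1 p.2) - f 1⌋)
    · rintro ⟨m, n⟩ hp
      have hp' : m < N ∧ n < N := by simpa [s] using hp
      have h1 := abs_le.1 (hbound m n hp'.1 hp'.2)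
      simp only [t, Finset.coe_Icc, Set.mem_Icc]
      constructor
      · rw [Int.le_floor]
        rw [Int.cast_neg, Int.cast_natCast]
        exact h1.1
      · have h2 := (Int.floor_le (f (P m n) - f 1)).trans h1.2
        exact_mod_cast h2
    · rintro ⟨m, n⟩ - ⟨m', n'⟩ - h
      have h1 := Int.abs_sub_lt_one_of_floor_eq_floor h
      have h2 := hsep m n m' n' (by simpa using h1)
      rw [h2.1, h2.2]
  have ht : t.card = 2 * (M * N) + 1 := by
    simp only [t, Int.card_Icc]
    omega
  have hs : s.card = N * N := by simp [s]
  rw [ht, hs] at hcard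
  have : N * N = 2 * (M * N) + N := by rw [hN]; ring
  omega
end

section
/- Let n ≥ 2 and let ξ ∈ ℂ satisfy ξ^n = 4. Define p_ξ ∈ (ℂ ∖ {0})^n by (p_ξ)_1 = 1 and (p_ξ)_k = ξ^{k−n−1} for 2 ≤ k ≤ n. Then all n complex partial derivatives of the superpotential W vanish at p_ξ (p_ξ is a critical point of W), and the critical value is W(p_ξ) = n·ξ. -/
open Finset

/-- The superpotential of the monotone Gelfand–Zeitlin torus `Tⁿ_GZ ⊂ Qⁿ` (Y. Kim):
`W(z₁, …, z_n) = 1/z_n + ∑_{k=2}^{n} z_k/z_{k−1} + 2z₂ + z₁z₂`, written in terms of a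
sequence of coordinates `z 1, …, z n`. -/
noncomputable def W (n : ℕ) (z : ℕ → ℂ) : ℂ :=
  1 / z n + (∑ k ∈ Finset.Icc 2 n, z k / z (k - 1)) + 2 * z 2 + z 1 * z 2

/-- Extension of a point `p ∈ ℂⁿ` (with coordinates `p 0, …, p (n−1)` standing for
`z₁, …, z_n`) to a sequence: `ext p k = z_k = p (k−1)` for `1 ≤ k ≤ n`, and `0` otherwise. -/
def ext {n : ℕ} (p : Fin n → ℂ) : ℕ → ℂ :=
  fun k => if h : 1 ≤ k ∧ k ≤ n then p ⟨k - 1, by omega⟩ else 0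

/-- The point `p_ξ ∈ (ℂ∖{0})ⁿ` with `(p_ξ)₁ = 1` and `(p_ξ)_k = ξ^{k−n−1}` for `2 ≤ k ≤ n`
(coordinate `i : Fin n` stands for `z_{i+1}`, so `(p_ξ)_{i+1} = ξ^{i−n}` for `i ≥ 1`). -/
noncomputable def pxi (n : ℕ) (ξ : ℂ) : Fin n → ℂ :=
  fun i => if (i : ℕ) = 0 then 1 else ξ ^ ((i : ℤ) - n)

/-- The coordinates of `p_ξ` as a sequence. -/
noncomputable def cseq (n : ℕ) (ξ : ℂ) (k : ℕ) : ℂ :=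
  if k = 1 then 1 else ξ ^ ((k : ℤ) - n - 1)

theorem ext_pxi (n : ℕ) (ξ : ℂ) (k : ℕ) (h1 : 1 ≤ k) (h2 : k ≤ n) :
    ext (pxi n ξ) k = cseq n ξ k := by
  unfold _root_.ext pxi cseq
  rw [dif_pos ⟨h1, h2⟩]
  by_cases h : k = 1
  · simp [h]
  · have : k - 1 ≠ 0 := by omega
    simp only [this, h, if_false]
    congr 1
    omega

theorem cseq_ne (n : ℕ) (ξ : ℂ) (h : ξ ≠ 0) (k : ℕ) : cseq n ξ k ≠ 0 := by
  unfold cseq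
  split_ifs
  · exact one_ne_zero
  · exact zpow_ne_zero _ h

theorem ext_update_deriv (n : ℕ) (p : Fin n → ℂ) (i : Fin n) (k : ℕ) :
    HasDerivAt (fun t : ℂ => ext (Function.update p i t) k)
      (if k = (i : ℕ) + 1 then 1 else 0) (p i) := by
  by_cases h : k = (i : ℕ) + 1
  · have : (fun t : ℂ => ext (Function.update p i t) k) = fun t => t := by
      funext t
      have hi := i.2
      unfold _root_.ext
      rw [dif_pos ⟨by omega, by omega⟩]
      have : (⟨k - 1, by omega⟩ : Fin n) = i := by ext; simp [h]
      rw [this]; simp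
    rw [this, if_pos h]
    exact hasDerivAt_id _
  · have : (fun t : ℂ => ext (Function.update p i t) k) = fun t => ext p k := by
      funext t
      unfold _root_.ext
      split_ifs with hk
      · rw [Function.update_of_ne]
        intro he
        apply h
        rw [← he]
        simp only
        omega
      · rfl
    rw [this, if_neg h]
    exact hasDerivAt_const _ _

theorem W_deriv (n : ℕ) (hn : 2 ≤ n) (p : Fin n → ℂ) (i : Fin n)
    (hz : ∀ k, 1 ≤ k → k ≤ n → ext p k ≠ 0) (d : ℕ → ℂ)
    (hd : ∀ k, HasDerivAt (fun t : ℂ => ext (Function.update p i t) k) (d k) (p i)) :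
    HasDerivAt (fun t : ℂ => W n (ext (Function.update p i t)))
      (-d n / ext p n ^ 2 + (∑ k ∈ Finset.Icc 2 n,
        (d k * ext p (k - 1) - ext p k * d (k - 1)) / ext p (k - 1) ^ 2)
        + 2 * d 2 + (d 1 * ext p 2 + ext p 1 * d 2)) (p i) := by
  have e : Function.update p i (p i) = p := Function.update_eq_self i p
  unfold W
  refine HasDerivAt.add (HasDerivAt.add (HasDerivAt.add ?_ ?_) ?_) ?_
  · have := (hd n).fun_inv (by rw [e]; exact hz n (by omega) le_rfl)
    simpa only [one_div, e] using this
  · apply HasDerivAt.fun_sum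
    intro k hk
    rw [Finset.mem_Icc] at hk
    have := (hd k).fun_div (hd (k-1)) (by rw [e]; exact hz _ (by omega) (by omega))
    simpa only [e] using this
  · exact (hd 2).const_mul 2
  · have := (hd 1).fun_mul (hd 2)
    simpa only [e] using this

theorem sum_eval (n m : ℕ) (h1 : 1 ≤ m) (h2 : m ≤ n) (c : ℕ → ℂ) (hc : ∀ k, c k ≠ 0) :
    (∑ k ∈ Finset.Icc 2 n, ((if k = m then 1 else 0) * c (k - 1)
      - c k * (if k - 1 = m then 1 else 0)) / c (k - 1) ^ 2)
    = (if m = 1 then 0 else 1 / c (m - 1)) - (if m = n then 0 else c (m + 1) / c m ^ 2) := by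
  have : ∀ k ∈ Finset.Icc 2 n, ((if k = m then 1 else 0) * c (k - 1)
      - c k * (if k - 1 = m then 1 else 0)) / c (k - 1) ^ 2
      = (if k = m then 1 / c (m - 1) else 0) - (if k = m + 1 then c (m + 1) / c m ^ 2 else 0) := by
    intro k hk
    rw [Finset.mem_Icc] at hk
    have h3 := hc (k - 1)
    by_cases ha : k = m
    · subst ha
      have : k - 1 ≠ k := by omega
      simp [this]
      field_simp
    · by_cases hb : k = m + 1
      · subst hb
        simp
        ring
      · have : k - 1 ≠ m := by omega
        simp [ha, hb, this]
  rw [Finset.sum_congr rfl this, Finset.sum_sub_distrib, Finset.sum_ite_eq', Finset.sum_ite_eq']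
  simp only [Finset.mem_Icc]
  congr 1
  · by_cases h : m = 1
    · simp [h]
    · rw [if_pos ⟨by omega, h2⟩, if_neg h]
  · by_cases h : m = n
    · simp [h]
    · rw [if_pos ⟨by omega, by omega⟩, if_neg h]

/-- For every `n`-th root `ξ` of `4`, the point `p_ξ` lies in `(ℂ∖{0})ⁿ`, all `n` complex
partial derivatives of the superpotential `W` vanish at `p_ξ` (it is a critical point),
and the critical value is `W(p_ξ) = n·ξ`. -/
theorem pxi_is_critical_point_of_superpotential (n : ℕ) (hn : 2 ≤ n) (ξ : ℂ)
    (hξ : ξ ^ n = 4) :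
    (∀ i : Fin n, pxi n ξ i ≠ 0) ∧
    (∀ i : Fin n,
      HasDerivAt (fun t : ℂ => W n (ext (Function.update (pxi n ξ) i t))) 0 (pxi n ξ i)) ∧
    W n (ext (pxi n ξ)) = n * ξ := by
  have h0 : ξ ≠ 0 := by
    rintro rfl
    rw [zero_pow (by omega)] at hξ
    norm_num at hξ
  have hc := cseq_ne n ξ h0
  have hz : ∀ k, 1 ≤ k → k ≤ n → ext (pxi n ξ) k ≠ 0 := by
    intro k h1 h2
    rw [ext_pxi n ξ k h1 h2]
    exact hc k
  have c1 : cseq n ξ 1 = 1 := by simp [cseq]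
  have c2 : ∀ k, 2 ≤ k → cseq n ξ k = ξ ^ k / (4 * ξ) := by
    intro k hk
    unfold cseq
    rw [if_neg (by omega), zpow_sub₀ h0, zpow_sub₀ h0, zpow_natCast, zpow_natCast, hξ, zpow_one,
      div_div]
  refine ⟨?_, ?_, ?_⟩
  · intro i
    unfold pxi
    split_ifs
    · exact one_ne_zero
    · exact zpow_ne_zero _ h0
  · intro i
    have hi := i.2
    have key := W_deriv n hn (pxi n ξ) i hz _ (ext_update_deriv n (pxi n ξ) i)
    convert key using 1
    obtain ⟨m, hm⟩ : ∃ m, m = (i : ℕ) + 1 := ⟨_, rfl⟩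
    rw [← hm]
    have hm1 : 1 ≤ m := by omega
    have hmn : m ≤ n := by omega
    have hs := sum_eval n m hm1 hmn (cseq n ξ) hc
    have hcg : (∑ k ∈ Finset.Icc 2 n, ((if k = m then 1 else 0) * ext (pxi n ξ) (k - 1)
        - ext (pxi n ξ) k * (if k - 1 = m then 1 else 0)) / ext (pxi n ξ) (k - 1) ^ 2)
        = (∑ k ∈ Finset.Icc 2 n, ((if k = m then 1 else 0) * cseq n ξ (k - 1)
        - cseq n ξ k * (if k - 1 = m then 1 else 0)) / cseq n ξ (k - 1) ^ 2) := by
      refine Finset.sum_congr rfl fun k hk => ?_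
      rw [Finset.mem_Icc] at hk
      rw [ext_pxi n ξ k (by omega) (by omega), ext_pxi n ξ (k - 1) (by omega) (by omega)]
    rw [hcg, hs, ext_pxi n ξ n (by omega) le_rfl, ext_pxi n ξ 1 le_rfl (by omega),
      ext_pxi n ξ 2 (by omega) hn, c1]
    by_cases m1 : m = 1
    · subst m1
      have : n ≠ 1 := by omega
      simp [this, this.symm, c1]
    -- the two boundary terms combine as if `z_{n+1} = 1`
    have hb : -(if n = m then (1 : ℂ) else 0) / cseq n ξ n ^ 2
        - (if m = n then 0 else cseq n ξ (m + 1) / cseq n ξ m ^ 2)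
        = - (cseq n ξ (m + 1) / cseq n ξ m ^ 2) := by
      by_cases h : m = n
      · subst h
        have : cseq m ξ (m + 1) = 1 := by
          rw [c2 _ (by omega), pow_succ, hξ]
          field_simp
        simp [this]
        ring
      · simp [h, Ne.symm h]
    have hq : cseq n ξ (m + 1) / cseq n ξ m ^ 2 = 4 * ξ ^ 2 / ξ ^ m := by
      rw [c2 _ (by omega), c2 _ (by omega)]
      field_simp
      ring
    by_cases m2 : m = 2
    · subst m2
      have hq4 : (4 : ℂ) * ξ ^ 2 / ξ ^ 2 = 4 := by field_simp
      rw [hq4] at hq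
      rw [hq] at hb ⊢
      simp only [show 2 - 1 = 1 from rfl, c1]
      norm_num
      norm_num at hb
      linear_combination -hb
    · have hp : 1 / cseq n ξ (m - 1) = 4 * ξ ^ 2 / ξ ^ m := by
        obtain ⟨j, rfl⟩ : ∃ j, m = j + 1 := ⟨m - 1, by omega⟩
        simp only [Nat.add_sub_cancel]
        rw [c2 _ (by omega)]
        field_simp
        ring
      rw [hp, if_neg m1, if_neg (Ne.symm m2), if_neg (Ne.symm m1)]
      rw [hq] at hb ⊢
      linear_combination -hb
  · unfold W
    rw [ext_pxi n ξ n (by omega) le_rfl, ext_pxi n ξ 1 le_rfl (by omega),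
      ext_pxi n ξ 2 (by omega) hn, ← Finset.add_sum_Ioc_eq_sum_Icc hn]
    have : ∀ k ∈ Finset.Ioc 2 n, ext (pxi n ξ) k / ext (pxi n ξ) (k - 1) = ξ := by
      intro k hk
      rw [Finset.mem_Ioc] at hk
      obtain ⟨j, rfl⟩ : ∃ j, k = j + 1 := ⟨k - 1, by omega⟩
      rw [ext_pxi n ξ _ (by omega) (by omega), ext_pxi n ξ _ (by omega) (by omega),
        c2 _ (by omega), c2 _ (by omega)]
      simp only [Nat.add_sub_cancel]
      field_simp
      ring
    rw [Finset.sum_congr rfl this, Finset.sum_const, Nat.card_Ioc, ext_pxi n ξ 2 (by omega) hn,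
      ext_pxi n ξ (2 - 1) (by omega) (by omega), c1, c2 n hn, c2 2 le_rfl, hξ, nsmul_eq_mul,
      Nat.cast_sub hn]
    push_cast
    field_simp
    ring
end
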